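/- For 0 < α < 1, let c_α = ( 2 ∫_ℝ (1 − cos u) |u|^{−2α−1} du )^{−1}, which is a finite positive constant. Then for all x, y ∈ ℝ: ½( |x|^{2α} + |y|^{2α} − |x − y|^{2α} ) = c_α ∫_ℝ [ (1 − cos(xξ))(1 − cos(yξ)) + sin(xξ) sin(yξ) ] |ξ|^{−2α−1} dξ. -/

import Mathlib

open MeasureTheory Filter Set

noncomputable section

theorem Real.one_sub_cos_nonneg (u : ℝ) : 0 ≤ 1 - Real.cos u := by
  linarith [Real.cos_le_one u]

theorem integrable_one_sub_cos_mul_abs_rpow {α : ℝ} (hα0 : 0 < α) (hα1 : α < 1) :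
    Integrable (fun u : ℝ => (1 - Real.cos u) * |u| ^ (-(2 * α) - 1)) := by
  have hmeas : Measurable (fun u : ℝ => (1 - Real.cos u) * |u| ^ (-(2 * α) - 1)) := by
    fun_prop
  have hIoc : IntegrableOn (fun u : ℝ => (1 - Real.cos u) * |u| ^ (-(2 * α) - 1)) (Ioc 0 1) := by
    have h : IntegrableOn (fun u : ℝ => u ^ (1 - 2 * α)) (Ioc 0 1) :=
      (intervalIntegrable_iff_integrableOn_Ioc_of_le zero_le_one).1
        (intervalIntegral.intervalIntegrable_rpow' (by linarith))
    refine h.mono' hmeas.aestronglyMeasurable ?_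
    refine (ae_restrict_iff' measurableSet_Ioc).2 (Eventually.of_forall fun u hu => ?_)
    have hp : 0 ≤ u ^ (-(2 * α) - 1) := Real.rpow_nonneg hu.1.le _
    rw [abs_of_pos hu.1, Real.norm_of_nonneg (mul_nonneg (Real.one_sub_cos_nonneg u) hp)]
    calc (1 - Real.cos u) * u ^ (-(2 * α) - 1) ≤ u ^ (2 : ℝ) * u ^ (-(2 * α) - 1) := by
          refine mul_le_mul_of_nonneg_right ?_ hp
          rw [Real.rpow_two]
          nlinarith [Real.one_sub_sq_div_two_le_cos (x := u)]
      _ = u ^ (1 - 2 * α) := by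
          rw [← Real.rpow_add hu.1]
          ring_nf
  have hIoi : IntegrableOn (fun u : ℝ => (1 - Real.cos u) * |u| ^ (-(2 * α) - 1)) (Ioi 1) := by
    have h : IntegrableOn (fun u : ℝ => 2 * u ^ (-(2 * α) - 1)) (Ioi 1) :=
      (integrableOn_Ioi_rpow_of_lt (by linarith) zero_lt_one).const_mul 2
    refine h.mono' hmeas.aestronglyMeasurable ?_
    refine (ae_restrict_iff' measurableSet_Ioi).2 (Eventually.of_forall fun u hu => ?_)
    have hu0 : 0 < u := zero_lt_one.trans hu
    have hp : 0 ≤ u ^ (-(2 * α) - 1) := Real.rpow_nonneg hu0.le _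
    rw [abs_of_pos hu0, Real.norm_of_nonneg (mul_nonneg (Real.one_sub_cos_nonneg u) hp)]
    exact mul_le_mul_of_nonneg_right (by linarith [Real.neg_one_le_cos u]) hp
  have hpos : IntegrableOn (fun u : ℝ => (1 - Real.cos u) * |u| ^ (-(2 * α) - 1)) (Ioi 0) := by
    rw [← Ioc_union_Ioi_eq_Ioi zero_le_one]
    exact hIoc.union hIoi
  have hneg : IntegrableOn (fun u : ℝ => (1 - Real.cos u) * |u| ^ (-(2 * α) - 1)) (Iic 0) := by
    have hemb : MeasurableEmbedding (Neg.neg : ℝ → ℝ) :=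
      (MeasurableEquiv.neg ℝ).measurableEmbedding
    rw [integrableOn_Iic_iff_integrableOn_Iio, ← Measure.map_neg_eq_self (volume : Measure ℝ),
      hemb.integrableOn_map_iff]
    simpa [Function.comp_def] using hpos
  rw [← integrableOn_univ, ← Iic_union_Ioi (a := (0 : ℝ))]
  exact hneg.union hpos

theorem integral_one_sub_cos_mul_abs_rpow_pos {α : ℝ} (hα0 : 0 < α) (hα1 : α < 1) :
    0 < ∫ u : ℝ, (1 - Real.cos u) * |u| ^ (-(2 * α) - 1) := by
  rw [integral_pos_iff_support_of_nonneg
    (fun u => mul_nonneg (Real.one_sub_cos_nonneg u) (Real.rpow_nonneg (abs_nonneg u) _))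
    (integrable_one_sub_cos_mul_abs_rpow hα0 hα1)]
  refine lt_of_lt_of_le ?_ (measure_mono (s := Ioo 0 1) fun u hu => ?_)
  · simp
  · have hcos : Real.cos u < 1 := by
      simpa using Real.cos_lt_cos_of_nonneg_of_le_pi le_rfl
        (hu.2.le.trans (by linarith [Real.pi_gt_three])) hu.1
    exact (mul_pos (sub_pos.2 hcos) (Real.rpow_pos_of_pos (abs_pos.2 hu.1.ne') _)).ne'

theorem one_sub_cos_mul_left_mul_abs_rpow {x : ℝ} (hx : x ≠ 0) (p ξ : ℝ) :
    (1 - Real.cos (x * ξ)) * |ξ| ^ p = |x| ^ (-p) * ((1 - Real.cos (x * ξ)) * |x * ξ| ^ p) := by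
  have h : |x| ^ (-p) * |x| ^ p = 1 := by
    rw [← Real.rpow_add (abs_pos.2 hx), neg_add_cancel, Real.rpow_zero]
  rw [abs_mul, Real.mul_rpow (abs_nonneg x) (abs_nonneg ξ)]
  linear_combination (-(1 - Real.cos (x * ξ)) * |ξ| ^ p) * h

theorem integrable_one_sub_cos_mul_left_mul_abs_rpow {α : ℝ} (hα0 : 0 < α) (hα1 : α < 1)
    (x : ℝ) : Integrable (fun ξ : ℝ => (1 - Real.cos (x * ξ)) * |ξ| ^ (-(2 * α) - 1)) := by
  rcases eq_or_ne x 0 with rfl | hx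
  · simp
  · simp_rw [one_sub_cos_mul_left_mul_abs_rpow hx]
    exact ((integrable_one_sub_cos_mul_abs_rpow hα0 hα1).comp_mul_left' hx).const_mul _

theorem integral_one_sub_cos_mul_left_mul_abs_rpow {α : ℝ} (hα0 : 0 < α) (x : ℝ) :
    ∫ ξ : ℝ, (1 - Real.cos (x * ξ)) * |ξ| ^ (-(2 * α) - 1) =
      |x| ^ (2 * α) * ∫ u : ℝ, (1 - Real.cos u) * |u| ^ (-(2 * α) - 1) := by
  rcases eq_or_ne x 0 with rfl | hx
  · simp [Real.zero_rpow (mul_pos two_pos hα0).ne']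
  · simp_rw [one_sub_cos_mul_left_mul_abs_rpow hx]
    rw [integral_const_mul, Measure.integral_comp_mul_left
      (fun u : ℝ => (1 - Real.cos u) * |u| ^ (-(2 * α) - 1)) x, smul_eq_mul, ← mul_assoc]
    congr 1
    rw [abs_inv, ← Real.rpow_neg_one, ← Real.rpow_add (abs_pos.2 hx)]
    ring_nf

/-- The spectral identity underlying the harmonizable representation of the fractional
Brownian sheet: with `c_α = (2 ∫_ℝ (1 − cos u) |u|^(−2α−1) du)⁻¹` (a finite positive
constant), for all `x, y ∈ ℝ`,
`½(|x|^(2α) + |y|^(2α) − |x−y|^(2α))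
  = c_α ∫_ℝ [(1 − cos xξ)(1 − cos yξ) + sin xξ sin yξ] |ξ|^(−2α−1) dξ`. -/
theorem fbs_spectral_identity (α : ℝ) (hα0 : 0 < α) (hα1 : α < 1) :
    Integrable (fun u : ℝ => (1 - Real.cos u) * |u| ^ (-(2 * α) - 1)) ∧
    0 < ∫ u : ℝ, (1 - Real.cos u) * |u| ^ (-(2 * α) - 1) ∧
    ∀ x y : ℝ,
      Integrable (fun ξ : ℝ =>
        ((1 - Real.cos (x * ξ)) * (1 - Real.cos (y * ξ)) +
          Real.sin (x * ξ) * Real.sin (y * ξ)) * |ξ| ^ (-(2 * α) - 1)) ∧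
      (|x| ^ (2 * α) + |y| ^ (2 * α) - |x - y| ^ (2 * α)) / 2 =
        (2 * ∫ u : ℝ, (1 - Real.cos u) * |u| ^ (-(2 * α) - 1))⁻¹ *
          ∫ ξ : ℝ, ((1 - Real.cos (x * ξ)) * (1 - Real.cos (y * ξ)) +
            Real.sin (x * ξ) * Real.sin (y * ξ)) * |ξ| ^ (-(2 * α) - 1) := by
  have hint := integrable_one_sub_cos_mul_left_mul_abs_rpow hα0 hα1
  have hK := integral_one_sub_cos_mul_abs_rpow_pos hα0 hα1
  refine ⟨integrable_one_sub_cos_mul_abs_rpow hα0 hα1, hK, fun x y => ?_⟩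
  have key : (fun ξ : ℝ =>
      ((1 - Real.cos (x * ξ)) * (1 - Real.cos (y * ξ)) +
        Real.sin (x * ξ) * Real.sin (y * ξ)) * |ξ| ^ (-(2 * α) - 1)) =
      fun ξ : ℝ => (1 - Real.cos (x * ξ)) * |ξ| ^ (-(2 * α) - 1) +
        (1 - Real.cos (y * ξ)) * |ξ| ^ (-(2 * α) - 1) -
        (1 - Real.cos ((x - y) * ξ)) * |ξ| ^ (-(2 * α) - 1) := by
    funext ξ
    rw [sub_mul x y ξ, Real.cos_sub]
    ring
  rw [key]
  refine ⟨((hint x).add (hint y)).sub (hint (x - y)), ?_⟩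
  rw [integral_sub (by exact (hint x).add (hint y)) (hint (x - y)),
    integral_add (hint x) (hint y)]
  simp only [integral_one_sub_cos_mul_left_mul_abs_rpow hα0]
  field_simp

end
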